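/- For every fixed r > 0, the function s ↦ θ₃(rs)·θ₃(r/s) − 2·θₒ(rs)·θₒ(r/s) on (0, ∞) attains its global minimum at s = 1; that is, for all s > 0, θ₃(rs)·θ₃(r/s) − 2·θₒ(rs)·θₒ(r/s) ≥ θ₃(r)² − 2·θₒ(r)². -/

import Mathlib

noncomputable def theta3 (s : ℝ) : ℝ := ∑' k : ℤ, Real.exp (-Real.pi * (k : ℝ) ^ 2 * s)

noncomputable def thetaO (s : ℝ) : ℝ := ∑' k : ℤ, Real.exp (-Real.pi * (2 * (k : ℝ) + 1) ^ 2 * s)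

open Real HurwitzZeta

/-- Dirichlet-type series `∑ c n * a n ^ j * exp (- a n * s)`. -/
noncomputable def dirT (c a : ℕ → ℝ) (j : ℕ) (s : ℝ) : ℝ :=
  ∑' n, c n * a n ^ j * rexp (-a n * s)

lemma dirT_bound (c a : ℕ → ℝ) (hc : ∀ n, |c n| ≤ 2) (ha : ∀ n : ℕ, 3 * ((n : ℝ) + 1) ≤ a n)
    (j : ℕ) (ε : ℝ) (hε : 0 < ε) : ∃ u : ℕ → ℝ, Summable u ∧
      ∀ n s, ε ≤ s → ‖c n * a n ^ j * rexp (-a n * s)‖ ≤ u n := by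
  refine ⟨fun n => 2 * (j.factorial * (2 / ε) ^ j) * (rexp (-(ε / 2))) ^ n, ?_, ?_⟩
  · apply Summable.mul_left
    apply summable_geometric_of_lt_one (exp_pos _).le
    rw [exp_lt_one_iff]; linarith
  · intro n s hs
    have hn : (0 : ℝ) ≤ n := Nat.cast_nonneg n
    have han : (n : ℝ) ≤ a n := by linarith [ha n]
    have ha0 : 0 ≤ a n := hn.trans han
    rw [norm_mul, norm_mul, norm_eq_abs, norm_eq_abs, norm_eq_abs, abs_of_pos (exp_pos _),
      abs_of_nonneg (pow_nonneg ha0 j), mul_assoc]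
    beta_reduce
    have h1 : a n ^ j ≤ j.factorial * (2 / ε) ^ j * rexp (a n * (ε / 2)) := by
      have := pow_div_factorial_le_exp (x := a n * (ε / 2)) (by positivity) j
      have hf : (0 : ℝ) < j.factorial := by positivity
      rw [div_le_iff₀ hf] at this
      calc a n ^ j = (2 / ε) ^ j * (a n * (ε / 2)) ^ j := by
            rw [← mul_pow]; congr 1; field_simp
        _ ≤ (2 / ε) ^ j * (rexp (a n * (ε / 2)) * j.factorial) := by gcongr
        _ = _ := by ring
    have h2 : rexp (a n * (ε / 2)) * rexp (-a n * s) ≤ rexp (-(ε / 2)) ^ n := by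
      rw [← exp_add, ← exp_nat_mul]
      apply exp_le_exp.2
      nlinarith [mul_le_mul_of_nonneg_left hs ha0]
    calc |c n| * (a n ^ j * rexp (-a n * s))
        ≤ 2 * ((j.factorial * (2 / ε) ^ j * rexp (a n * (ε / 2))) * rexp (-a n * s)) := by
          gcongr; exact hc n
      _ = 2 * ((j.factorial * (2 / ε) ^ j) * (rexp (a n * (ε / 2)) * rexp (-a n * s))) := by ring
      _ ≤ 2 * ((j.factorial * (2 / ε) ^ j) * (rexp (-(ε / 2)) ^ n)) := by gcongr
      _ = _ := by ring

lemma dirT_summable (c a : ℕ → ℝ) (hc : ∀ n, |c n| ≤ 2) (ha : ∀ n : ℕ, 3 * ((n : ℝ) + 1) ≤ a n)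
    (j : ℕ) (s : ℝ) (hs : 0 < s) : Summable fun n => c n * a n ^ j * rexp (-a n * s) := by
  obtain ⟨u, hu, h⟩ := dirT_bound c a hc ha j s hs
  exact Summable.of_norm_bounded hu fun n => h n s le_rfl

lemma dirT_hasDerivAt (c a : ℕ → ℝ) (hc : ∀ n, |c n| ≤ 2) (ha : ∀ n : ℕ, 3 * ((n : ℝ) + 1) ≤ a n)
    (j : ℕ) (s : ℝ) (hs : 0 < s) : HasDerivAt (dirT c a j) (-dirT c a (j + 1) s) s := by
  obtain ⟨u, hu, h⟩ := dirT_bound c a hc ha (j + 1) (s / 2) (by linarith)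
  have := hasDerivAt_tsum_of_isPreconnected (𝕜 := ℝ) (F := ℝ) (u := u) (t := Set.Ioi (s / 2))
    (g := fun n s => c n * a n ^ j * rexp (-a n * s))
    (g' := fun n s => -(c n * a n ^ (j + 1) * rexp (-a n * s))) (y₀ := s) (y := s)
    hu isOpen_Ioi isPreconnected_Ioi ?_ ?_ ?_ ?_ ?_
  · rw [tsum_neg] at this
    exact this
  · intro n y hy
    have h1 : HasDerivAt (fun y => -a n * y) (-a n) y := by
      simpa using (hasDerivAt_id y).const_mul (-a n)
    have := (h1.exp).const_mul (c n * a n ^ j)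
    convert! this using 1
    ring
  · intro n y hy
    rw [norm_neg]
    exact h n y (le_of_lt hy)
  · simp; linarith
  · exact dirT_summable c a hc ha j s hs
  · simp; linarith

/-- logarithm in exponential coordinates -/
noncomputable def lg (c a : ℕ → ℝ) (x : ℝ) : ℝ := Real.log (1 + dirT c a 0 (rexp x))
noncomputable def lg' (c a : ℕ → ℝ) (x : ℝ) : ℝ :=
  -(rexp x * dirT c a 1 (rexp x)) / (1 + dirT c a 0 (rexp x))
noncomputable def lg'' (c a : ℕ → ℝ) (x : ℝ) : ℝ :=
  (((rexp x) ^ 2 * dirT c a 2 (rexp x) - rexp x * dirT c a 1 (rexp x))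
    * (1 + dirT c a 0 (rexp x)) - (rexp x * dirT c a 1 (rexp x)) ^ 2)
    / (1 + dirT c a 0 (rexp x)) ^ 2

lemma lg_deriv (c a : ℕ → ℝ) (hc : ∀ n, |c n| ≤ 2) (ha : ∀ n : ℕ, 3 * ((n : ℝ) + 1) ≤ a n)
    (hpos : ∀ s, 0 < s → 0 < 1 + dirT c a 0 s) (x : ℝ) :
    HasDerivAt (lg c a) (lg' c a x) x := by
  have h0 := (dirT_hasDerivAt c a hc ha 0 (rexp x) (exp_pos x)).comp x (Real.hasDerivAt_exp x)
  have := (h0.const_add 1).log (hpos _ (exp_pos x)).ne'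
  convert! this using 1
  simp [lg']; ring

lemma lg_deriv' (c a : ℕ → ℝ) (hc : ∀ n, |c n| ≤ 2) (ha : ∀ n : ℕ, 3 * ((n : ℝ) + 1) ≤ a n)
    (hpos : ∀ s, 0 < s → 0 < 1 + dirT c a 0 s) (x : ℝ) :
    HasDerivAt (lg' c a) (lg'' c a x) x := by
  have h0 := (dirT_hasDerivAt c a hc ha 0 (rexp x) (exp_pos x)).comp x (Real.hasDerivAt_exp x)
  have h1 := (dirT_hasDerivAt c a hc ha 1 (rexp x) (exp_pos x)).comp x (Real.hasDerivAt_exp x)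
  have := (((Real.hasDerivAt_exp x).mul h1).neg).div (h0.const_add 1) (hpos _ (exp_pos x)).ne'
  convert! this using 1
  simp [lg'']; ring

lemma midpoint_aux (A A' A'' B B' B'' : ℝ → ℝ) (κ : ℝ)
    (hA : ∀ x, HasDerivAt A (A' x) x) (hA' : ∀ x, HasDerivAt A' (A'' x) x)
    (hB : ∀ x, HasDerivAt B (B' x) x) (hB' : ∀ x, HasDerivAt B' (B'' x) x)
    (hAB : ∀ x, A x = κ * x + B (-x))
    (hA0 : ∀ x, 0 ≤ x → 0 ≤ A'' x) (hB0 : ∀ x, 0 ≤ x → 0 ≤ B'' x) (x t : ℝ) :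
    2 * A x ≤ A (x + t) + A (x - t) := by
  have e1 : ∀ x, A' x = κ - B' (-x) := by
    intro x
    have h := ((hasDerivAt_id x).const_mul κ).add ((hB (-x)).comp x (hasDerivAt_neg x))
    have h2 : HasDerivAt A (κ * 1 + B' (-x) * -1) x := by
      convert! h using 1
      funext y; simp [hAB]
    rw [(hA x).unique h2]; ring
  have e2 : ∀ x, A'' x = B'' (-x) := by
    intro x
    have h := ((hB' (-x)).comp x (hasDerivAt_neg x)).const_sub κ
    have h2 : HasDerivAt A' (-(B'' (-x) * -1)) x := by
      convert! h using 1
      funext y; simp [e1]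
    rw [(hA' x).unique h2]; ring
  have h3 : ∀ x, 0 ≤ A'' x := by
    intro x
    rcases le_total 0 x with h | h
    · exact hA0 x h
    · rw [e2]; exact hB0 _ (by linarith)
  have hconv : ConvexOn ℝ Set.univ A := by
    apply convexOn_of_hasDerivWithinAt2_nonneg convex_univ (f' := A') (f'' := A'')
    · exact fun x _ => (hA x).continuousAt.continuousWithinAt
    · exact fun x _ => (hA x).hasDerivWithinAt
    · exact fun x _ => (hA' x).hasDerivWithinAt
    · exact fun x _ => h3 x
  have := hconv.2 (Set.mem_univ (x + t)) (Set.mem_univ (x - t))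
    (show (0 : ℝ) ≤ 1 / 2 by norm_num) (show (0 : ℝ) ≤ 1 / 2 by norm_num) (by norm_num)
  simp only [smul_eq_mul] at this
  rw [show 1 / 2 * (x + t) + 1 / 2 * (x - t) = x by ring] at this
  linarith

lemma exp_three_halves : rexp (-(3 / 2)) ≤ 1 / 4 := by
  have h := Real.exp_one_gt_d9
  have h1 : rexp (3 / 2) ^ 2 = rexp 1 ^ 3 := by
    rw [← exp_nat_mul, ← exp_nat_mul]; norm_num
  have h3 : (2.7 : ℝ) ^ 3 ≤ rexp 1 ^ 3 := by gcongr; linarith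
  have h2 : 4 ≤ rexp (3 / 2) := by
    nlinarith [exp_pos (3 / 2 : ℝ)]
  rw [exp_neg, inv_le_comm₀ (exp_pos _) (by norm_num)]
  norm_num; exact h2

lemma sq_exp_bound (v : ℝ) (n : ℕ) (hv : 3 * ((n : ℝ) + 1) ≤ v) :
    v ^ 2 * rexp (-v) ≤ 9 / 4 * ((1 / 4) * (1 / 4) ^ n) := by
  have hn : (0 : ℝ) ≤ n := Nat.cast_nonneg n
  have h1 := Real.add_one_le_exp (v / 4 - 1)
  have h2 : v ≤ 4 * rexp (v / 4 - 1) := by linarith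
  have h3 : v ^ 2 ≤ 16 * (rexp (-2) * rexp (v / 2)) := by
    calc v ^ 2 ≤ (4 * rexp (v / 4 - 1)) ^ 2 := by gcongr; linarith
      _ = _ := by
        rw [mul_pow, ← exp_add, ← exp_nat_mul]; norm_num; ring_nf
  have he : rexp (-2) ≤ 9 / 64 := by
    have h := Real.exp_one_gt_d9
    have h1 : rexp 2 = rexp 1 ^ 2 := by rw [← exp_nat_mul]; norm_num
    rw [exp_neg, inv_le_comm₀ (exp_pos _) (by norm_num), h1]
    nlinarith
  have h4 : rexp (v / 2) * rexp (-v) ≤ (1 / 4) * (1 / 4) ^ n := by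
    rw [← exp_add, ← pow_succ']
    calc rexp (v / 2 + -v) ≤ rexp (((n + 1 : ℕ) : ℝ) * (-(3 / 2))) := by
          apply exp_le_exp.2; push_cast; linarith
      _ = rexp (-(3 / 2)) ^ (n + 1) := by rw [exp_nat_mul]
      _ ≤ _ := by gcongr; exact exp_three_halves
  calc v ^ 2 * rexp (-v) ≤ 16 * (rexp (-2) * rexp (v / 2)) * rexp (-v) := by gcongr
    _ = 16 * rexp (-2) * (rexp (v / 2) * rexp (-v)) := by ring
    _ ≤ 16 * (9 / 64) * ((1 / 4) * (1 / 4) ^ n) := by gcongr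
    _ = _ := by ring

lemma T2_bound (c a : ℕ → ℝ) (C : ℝ) (hc0 : ∀ n, 0 ≤ c n) (hC : ∀ n, c n ≤ C) (hC2 : C ≤ 2)
    (ha : ∀ n : ℕ, 3 * ((n : ℝ) + 1) ≤ a n)
    (s : ℝ) (hs : 1 ≤ s) : s ^ 2 * dirT c a 2 s ≤ C * (3 / 4) := by
  have hc : ∀ n, |c n| ≤ 2 := fun n => by rw [abs_of_nonneg (hc0 n)]; exact (hC n).trans hC2
  have hS := (dirT_summable c a hc ha 2 s (by linarith)).hasSum.mul_left (s ^ 2)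
  have hG := ((hasSum_geometric_of_lt_one (r := (1 / 4 : ℝ)) (by norm_num) (by norm_num)).mul_left
    (1 / 4)).mul_left (9 / 4) |>.mul_left C
  refine (hasSum_le (fun n => ?_) hS hG).trans (le_of_eq (by norm_num))
  have hn : (0 : ℝ) ≤ n := Nat.cast_nonneg n
  have hv : 3 * ((n : ℝ) + 1) ≤ a n * s := by nlinarith [ha n]
  have := sq_exp_bound (a n * s) n hv
  have hCn := hC n
  have h0 := hc0 n
  calc s ^ 2 * (c n * a n ^ 2 * rexp (-a n * s))
      = c n * ((a n * s) ^ 2 * rexp (-(a n * s))) := by rw [neg_mul]; ring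
    _ ≤ c n * (9 / 4 * ((1 / 4) * (1 / 4) ^ n)) := by gcongr
    _ ≤ _ := by gcongr

lemma T1_le_T2 (c a : ℕ → ℝ) (hc0 : ∀ n, 0 ≤ c n) (hc : ∀ n, |c n| ≤ 2)
    (ha : ∀ n : ℕ, 3 * ((n : ℝ) + 1) ≤ a n)
    (s : ℝ) (hs : 1 ≤ s) : 3 * (s * dirT c a 1 s) ≤ s ^ 2 * dirT c a 2 s := by
  have hS := (dirT_summable c a hc ha 2 s (by linarith)).hasSum.mul_left (s ^ 2)
  have hS1 := ((dirT_summable c a hc ha 1 s (by linarith)).hasSum.mul_left s).mul_left 3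
  refine (hasSum_le (fun n => ?_) hS1 hS)
  have hn : (0 : ℝ) ≤ n := Nat.cast_nonneg n
  have hv : 3 ≤ a n * s := by nlinarith [ha n]
  have h0 := hc0 n
  have h2 : 0 ≤ c n * (a n * s) * rexp (-a n * s) := by positivity
  nlinarith

lemma dirT_nonneg (c a : ℕ → ℝ) (hc0 : ∀ n, 0 ≤ c n)
    (ha : ∀ n : ℕ, 3 * ((n : ℝ) + 1) ≤ a n) (j : ℕ) (s : ℝ) : 0 ≤ dirT c a j s := by
  apply tsum_nonneg
  intro n
  have hn : (0 : ℝ) ≤ n := Nat.cast_nonneg n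
  have := ha n
  have h0 := hc0 n
  have : 0 ≤ a n := by linarith
  positivity

/-- coefficients -/
noncomputable def aSq (n : ℕ) : ℝ := π * ((n : ℝ) + 1) ^ 2
noncomputable def aPr (n : ℕ) : ℝ := π * (((n : ℝ) + 1) * ((n : ℝ) + 2))
noncomputable def c3 (_ : ℕ) : ℝ := 2
noncomputable def c4 (n : ℕ) : ℝ := 2 * (-1) ^ (n + 1)
noncomputable def c2 (_ : ℕ) : ℝ := 1

lemma haSq (n : ℕ) : 3 * ((n : ℝ) + 1) ≤ aSq n := by
  have hn : (0 : ℝ) ≤ n := Nat.cast_nonneg n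
  have := pi_gt_three
  unfold aSq
  gcongr
  nlinarith

lemma haPr (n : ℕ) : 3 * ((n : ℝ) + 1) ≤ aPr n := by
  have hn : (0 : ℝ) ≤ n := Nat.cast_nonneg n
  have := pi_gt_three
  unfold aPr
  gcongr
  nlinarith

lemma hc3 (n : ℕ) : |c3 n| ≤ 2 := by simp [c3]
lemma hc4 (n : ℕ) : |c4 n| ≤ 2 := by simp [c4, abs_mul]
lemma hc2 (n : ℕ) : |c2 n| ≤ 2 := by simp [c2]

lemma theta3_eq_cos (s : ℝ) (hs : 0 < s) : cosKernel (0 : ℝ) s = 1 + dirT c3 aSq 0 s := by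
  have h := hasSum_nat_cosKernel₀ 0 hs
  have h2 : dirT c3 aSq 0 s = cosKernel (0 : ℝ) s - 1 := by
    rw [← h.tsum_eq]
    unfold dirT
    congr 1; funext n
    simp [c3, aSq]
  rw [h2]; ring

lemma theta4_eq_cos (s : ℝ) (hs : 0 < s) : cosKernel ((1 / 2 : ℝ)) s = 1 + dirT c4 aSq 0 s := by
  have h := hasSum_nat_cosKernel₀ (1 / 2) hs
  have h2 : dirT c4 aSq 0 s = cosKernel ((1 / 2 : ℝ)) s - 1 := by
    rw [← h.tsum_eq]
    unfold dirT
    congr 1; funext n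
    have : Real.cos (2 * π * (1 / 2) * (n + 1)) = (-1) ^ (n + 1) := by
      rw [← Real.cos_nat_mul_pi]; congr 1; push_cast; ring
    rw [this]
    simp [c4, aSq]
  rw [h2]; ring

lemma theta3_eq (s : ℝ) (hs : 0 < s) : theta3 s = 1 + dirT c3 aSq 0 s := by
  rw [← theta3_eq_cos s hs]
  have h := hasSum_int_evenKernel 0 hs
  have e := congrFun evenKernel_eq_cosKernel_of_zero s
  unfold theta3
  simp only [add_zero] at h
  rw [h.tsum_eq]
  simpa using e

lemma theta2_eq (s : ℝ) (hs : 0 < s) :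
    evenKernel ((1 / 2 : ℝ)) s = 2 * rexp (-(π / 4) * s) * (1 + dirT c2 aPr 0 s) := by
  have h := (hasSum_int_evenKernel (1 / 2) hs).nat_add_neg_add_one
  have hS := dirT_summable c2 aPr hc2 haPr 0 s hs
  have h1 : HasSum (fun n : ℕ => rexp (-(π * ((n : ℝ) * (n + 1))) * s)) (1 + dirT c2 aPr 0 s) := by
    rw [← hasSum_nat_add_iff' 1]
    convert! hS.hasSum using 1
    · funext n
      simp only [c2, aPr, pow_zero, one_mul]
      congr 1; push_cast; ring
    · simp [dirT]
  refine h.unique ?_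
  convert! h1.mul_left (2 * rexp (-(π / 4) * s)) using 1
  funext n
  rw [mul_assoc 2, ← exp_add, two_mul]
  congr 2 <;> (push_cast; ring)

lemma thetaO_eq (s : ℝ) (hs : 0 < s) : thetaO s = evenKernel ((1 / 2 : ℝ)) (4 * s) := by
  rw [← (hasSum_int_evenKernel (1 / 2) (show 0 < 4 * s by linarith)).tsum_eq]
  unfold thetaO
  congr 1; funext n; congr 1; ring

lemma pos3 (s : ℝ) (_hs : 0 < s) : 0 < 1 + dirT c3 aSq 0 s := by
  have := dirT_nonneg c3 aSq (fun n => by simp [c3]) haSq 0 s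
  linarith

lemma pos2 (s : ℝ) (_hs : 0 < s) : 0 < 1 + dirT c2 aPr 0 s := by
  have := dirT_nonneg c2 aPr (fun n => by simp [c2]) haPr 0 s
  linarith

lemma fe2 (x : ℝ) (hx : 0 < x) : 2 * rexp (-(π / 4) * x) * (1 + dirT c2 aPr 0 x) =
    1 / x ^ (1 / 2 : ℝ) * (1 + dirT c4 aSq 0 (1 / x)) := by
  rw [← theta2_eq x hx, evenKernel_functional_equation, theta4_eq_cos _ (by positivity)]

lemma pos4 (s : ℝ) (hs : 0 < s) : 0 < 1 + dirT c4 aSq 0 s := by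
  have h := fe2 (1 / s) (by positivity)
  have h2 := pos2 (1 / s) (by positivity)
  have h3 : 0 < 2 * rexp (-(π / 4) * (1 / s)) * (1 + dirT c2 aPr 0 (1 / s)) := by positivity
  rw [h, one_div_one_div] at h3
  exact pos_of_mul_pos_right h3 (by positivity)

lemma fe3 (x : ℝ) (hx : 0 < x) : (1 + dirT c3 aSq 0 x) =
    1 / x ^ (1 / 2 : ℝ) * (1 + dirT c3 aSq 0 (1 / x)) := by
  have h := evenKernel_functional_equation ((0 : ℝ) : UnitAddCircle) x
  have e := congrFun evenKernel_eq_cosKernel_of_zero x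
  rw [← theta3_eq_cos x hx, ← theta3_eq_cos _ (by positivity), ← h]
  simpa using e.symm

lemma est3 (x : ℝ) (hx : 0 ≤ x) : 0 ≤ lg'' c3 aSq x := by
  unfold lg''
  have hs : 1 ≤ rexp x := one_le_exp hx
  have hn : ∀ n, 0 ≤ c3 n := fun n => by simp [c3]
  have h1 := T1_le_T2 c3 aSq hn hc3 haSq _ hs
  have h2 := T2_bound c3 aSq 2 hn (fun n => by simp [c3]) le_rfl haSq _ hs
  have h0 := dirT_nonneg c3 aSq hn haSq 0 (rexp x)
  have h3 := dirT_nonneg c3 aSq hn haSq 1 (rexp x)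
  have h4 : 0 ≤ rexp x * dirT c3 aSq 1 (rexp x) := by positivity
  apply div_nonneg _ (by positivity)
  generalize rexp x * dirT c3 aSq 1 (rexp x) = p at *
  generalize rexp x ^ 2 * dirT c3 aSq 2 (rexp x) = q at *
  generalize dirT c3 aSq 0 (rexp x) = w at *
  nlinarith [mul_nonneg (show 0 ≤ q - p by linarith) h0]

lemma est2 (x : ℝ) (hx : 0 ≤ x) : lg'' c2 aPr x ≤ π / 4 * rexp x := by
  unfold lg''
  have hs : 1 ≤ rexp x := one_le_exp hx
  have hn : ∀ n, 0 ≤ c2 n := fun n => by simp [c2]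
  have h2 := T2_bound c2 aPr 1 hn (fun n => by simp [c2]) (by norm_num) haPr _ hs
  have h0 := dirT_nonneg c2 aPr hn haPr 0 (rexp x)
  have h3 := dirT_nonneg c2 aPr hn haPr 1 (rexp x)
  have h5 := dirT_nonneg c2 aPr hn haPr 2 (rexp x)
  have h4 : 0 ≤ rexp x * dirT c2 aPr 1 (rexp x) := by positivity
  have hp : 3 / 4 ≤ π / 4 * rexp x := by nlinarith [pi_gt_three]
  refine le_trans ?_ hp
  rw [div_le_iff₀ (by positivity)]
  generalize rexp x * dirT c2 aPr 1 (rexp x) = p at *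
  generalize rexp x ^ 2 * dirT c2 aPr 2 (rexp x) = q at *
  generalize dirT c2 aPr 0 (rexp x) = w at *
  nlinarith [mul_nonneg h4 h0, mul_nonneg (show 0 ≤ 1 * (3 / 4) - q by linarith) h0]

lemma term4 (u : ℝ) (hu : 3 ≤ u) (n : ℕ) :
    (u * ((n : ℝ) + 2) ^ 2) ^ 2 * rexp (-(u * ((n : ℝ) + 2) ^ 2)) ≤
      u * (u - 1) * rexp (-u) * (1 / 2 * (1 / 2) ^ n) := by
  have hn : (0 : ℝ) ≤ n := Nat.cast_nonneg n
  obtain ⟨m, hm⟩ : ∃ m : ℝ, m = ((n : ℝ) + 2) ^ 2 - 1 := ⟨_, rfl⟩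
  have hm' : ((n : ℝ) + 2) ^ 2 = m + 1 := by linarith
  have hm3 : 3 * ((n : ℝ) + 1) ≤ m := by nlinarith
  rw [hm']
  have h1 : (m + 1) ^ 2 ≤ rexp (2 * m) := by
    have := Real.add_one_le_exp m
    calc (m + 1) ^ 2 ≤ rexp m ^ 2 := by gcongr; linarith
      _ = _ := by rw [← exp_nat_mul]; norm_num
  have h2 : rexp (-(u * (m + 1))) ≤ rexp (-u) * rexp (-(3 * m)) := by
    rw [← exp_add]; apply exp_le_exp.2; nlinarith
  have h3 : rexp (2 * m) * rexp (-(3 * m)) ≤ (1 / 4) * (1 / 4) ^ n := by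
    rw [← exp_add, ← pow_succ']
    calc rexp (2 * m + -(3 * m)) ≤ rexp (((n + 1 : ℕ) : ℝ) * (-(3 / 2))) := by
          apply exp_le_exp.2; push_cast; linarith
      _ = rexp (-(3 / 2)) ^ (n + 1) := by rw [exp_nat_mul]
      _ ≤ _ := by gcongr; exact exp_three_halves
  have h4 : u ^ 2 ≤ 2 * (u * (u - 1)) := by nlinarith
  have h5 : (1 / 4 : ℝ) ^ n ≤ (1 / 2) ^ n := by gcongr; norm_num
  have h6 : 0 ≤ u * (u - 1) := by nlinarith
  calc (u * (m + 1)) ^ 2 * rexp (-(u * (m + 1)))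
      = u ^ 2 * (m + 1) ^ 2 * rexp (-(u * (m + 1))) := by ring
    _ ≤ (2 * (u * (u - 1))) * rexp (2 * m) * (rexp (-u) * rexp (-(3 * m))) := by gcongr
    _ = (2 * (u * (u - 1))) * rexp (-u) * (rexp (2 * m) * rexp (-(3 * m))) := by ring
    _ ≤ (2 * (u * (u - 1))) * rexp (-u) * ((1 / 4) * (1 / 2) ^ n) := by
      apply mul_le_mul_of_nonneg_left (h3.trans (by gcongr)) (by positivity)
    _ = _ := by ring

lemma est4_num (s : ℝ) (hs : 1 ≤ s) : s ^ 2 * dirT c4 aSq 2 s - s * dirT c4 aSq 1 s ≤ 0 := by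
  have hS := ((dirT_summable c4 aSq hc4 haSq 2 s (by linarith)).hasSum.mul_left (s ^ 2)).sub
    ((dirT_summable c4 aSq hc4 haSq 1 s (by linarith)).hasSum.mul_left s)
  have hu : 3 ≤ π * s := by nlinarith [pi_gt_three]
  rw [← hasSum_nat_add_iff' 1] at hS
  have hG := ((hasSum_geometric_of_lt_one (r := (1 / 2 : ℝ)) (by norm_num) (by norm_num)).mul_left
    (1 / 2)).mul_left (2 * ((π * s) * (π * s - 1) * rexp (-(π * s))))
  have := hasSum_le (fun n => ?_) hS hG
  · simp [c4, aSq] at this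
    unfold dirT at *
    simp only [c4, aSq] at *
    norm_num at *
    nlinarith
  · have ht := term4 (π * s) hu n
    have hn : (0 : ℝ) ≤ n := Nat.cast_nonneg n
    simp only [c4, aSq]
    push_cast
    have hv : 3 ≤ π * s * ((n : ℝ) + 2) ^ 2 := by nlinarith
    have e : -(π * ((n : ℝ) + 1 + 1) ^ 2) * s = -(π * s * ((n : ℝ) + 2) ^ 2) := by ring
    rw [e]
    have e2 : s ^ 2 * (2 * (-1) ^ (n + 1 + 1) * (π * ((n : ℝ) + 1 + 1) ^ 2) ^ 2 *
        rexp (-(π * s * ((n : ℝ) + 2) ^ 2))) - s * (2 * (-1) ^ (n + 1 + 1) *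
        (π * ((n : ℝ) + 1 + 1) ^ 2) ^ 1 * rexp (-(π * s * ((n : ℝ) + 2) ^ 2)))
        = (-1) ^ n * (2 * ((π * s * ((n : ℝ) + 2) ^ 2) * (π * s * ((n : ℝ) + 2) ^ 2 - 1) *
          rexp (-(π * s * ((n : ℝ) + 2) ^ 2)))) := by
      ring
    rw [e2]
    generalize π * s * ((n : ℝ) + 2) ^ 2 = v at *
    have hE := exp_pos (-v)
    have h7 : v * (v - 1) * rexp (-v) ≤ v ^ 2 * rexp (-v) := by
      gcongr; nlinarith
    have h8 : 0 ≤ v * (v - 1) * rexp (-v) := by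
      have : 0 ≤ v * (v - 1) := by nlinarith
      positivity
    have h9 : ((-1 : ℝ)) ^ n ≤ 1 := by
      rcases neg_one_pow_eq_or ℝ n with h | h <;> rw [h]; norm_num
    calc (-1) ^ n * (2 * (v * (v - 1) * rexp (-v))) ≤ 1 * (2 * (v * (v - 1) * rexp (-v))) := by
          gcongr
      _ ≤ _ := by linarith

lemma est4 (x : ℝ) (hx : 0 ≤ x) : lg'' c4 aSq x ≤ 0 := by
  unfold lg''
  have hs : 1 ≤ rexp x := one_le_exp hx
  have h1 := est4_num _ hs
  have h2 := pos4 _ (exp_pos x)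
  apply div_nonpos_of_nonpos_of_nonneg _ (by positivity)
  nlinarith [sq_nonneg (rexp x * dirT c4 aSq 1 (rexp x)), mul_nonneg (neg_nonneg.2 h1) h2.le]

lemma log_fe (x : ℝ) : Real.log (1 / (rexp x) ^ (1 / 2 : ℝ)) = -1 / 2 * x := by
  rw [one_div, Real.log_inv, Real.log_rpow (exp_pos x), Real.log_exp]; ring

lemma mid3 (x t : ℝ) : 2 * lg c3 aSq x ≤ lg c3 aSq (x + t) + lg c3 aSq (x - t) := by
  apply midpoint_aux (lg c3 aSq) (lg' c3 aSq) (lg'' c3 aSq) (lg c3 aSq) (lg' c3 aSq) (lg'' c3 aSq)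
    (-1 / 2) (lg_deriv _ _ hc3 haSq pos3) (lg_deriv' _ _ hc3 haSq pos3)
    (lg_deriv _ _ hc3 haSq pos3) (lg_deriv' _ _ hc3 haSq pos3) _ est3 est3
  intro x
  unfold lg
  have h := exp_pos x
  have hp := pos3 (1 / rexp x) (by positivity)
  rw [fe3 _ h, Real.log_mul (by positivity) hp.ne', log_fe, exp_neg, one_div (rexp x)]

lemma mid2 (x t : ℝ) : (π / 4 * rexp (x + t) - lg c2 aPr (x + t)) +
    (π / 4 * rexp (x - t) - lg c2 aPr (x - t)) ≥ 2 * (π / 4 * rexp x - lg c2 aPr x) := by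
  have key := midpoint_aux (fun x => π / 4 * rexp x - lg c2 aPr x)
    (fun x => π / 4 * rexp x - lg' c2 aPr x) (fun x => π / 4 * rexp x - lg'' c2 aPr x)
    (fun x => Real.log 2 - lg c4 aSq x) (fun x => -lg' c4 aSq x) (fun x => -lg'' c4 aSq x)
    (1 / 2)
    (fun x => ((Real.hasDerivAt_exp x).const_mul _).sub (lg_deriv _ _ hc2 haPr pos2 x))
    (fun x => ((Real.hasDerivAt_exp x).const_mul _).sub (lg_deriv' _ _ hc2 haPr pos2 x))
    (fun x => (lg_deriv _ _ hc4 haSq pos4 x).const_sub _)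
    (fun x => (lg_deriv' _ _ hc4 haSq pos4 x).neg) ?_
    (fun x hx => sub_nonneg.2 (est2 x hx)) (fun x hx => neg_nonneg.2 (est4 x hx)) x t
  · exact key
  · intro x
    have h := exp_pos x
    have hp := pos4 (1 / rexp x) (by positivity)
    have hp2 := pos2 (rexp x) h
    have h1 := congrArg Real.log (fe2 _ h)
    rw [Real.log_mul (by positivity) hp.ne', log_fe, Real.log_mul (by positivity) hp2.ne',
      Real.log_mul (by positivity) (by positivity), Real.log_exp] at h1
    simp only [lg]
    rw [exp_neg, ← one_div (rexp x)]
    linarith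

lemma main3 (r s : ℝ) (hr : 0 < r) (hs : 0 < s) :
    theta3 r ^ 2 ≤ theta3 (r * s) * theta3 (r / s) := by
  have h := mid3 (Real.log r) (Real.log s)
  unfold lg at h
  rw [exp_add, exp_sub, Real.exp_log hr, Real.exp_log hs] at h
  have h1 : 0 < r * s := by positivity
  have h2 : 0 < r / s := by positivity
  have p0 := pos3 r hr
  have p1 := pos3 _ h1
  have p2 := pos3 _ h2
  rw [theta3_eq r hr, theta3_eq _ h1, theta3_eq _ h2]
  rw [← Real.log_le_log_iff (by positivity) (by positivity), Real.log_pow,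
    Real.log_mul p1.ne' p2.ne']
  exact_mod_cast h

lemma main2 (r s : ℝ) (hr : 0 < r) (hs : 0 < s) :
    thetaO (r * s) * thetaO (r / s) ≤ thetaO r ^ 2 := by
  have hr4 : 0 < 4 * r := by linarith
  have h := mid2 (Real.log (4 * r)) (Real.log s)
  unfold lg at h
  rw [exp_add, exp_sub, Real.exp_log hr4, Real.exp_log hs] at h
  have h1 : 0 < 4 * r * s := by positivity
  have h2 : 0 < 4 * r / s := by positivity
  have p0 := pos2 _ hr4
  have p1 := pos2 _ h1
  have p2 := pos2 _ h2
  rw [thetaO_eq r hr, thetaO_eq _ (by positivity), thetaO_eq _ (by positivity),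
    ← mul_assoc, ← mul_div_assoc, theta2_eq _ hr4, theta2_eq _ h1, theta2_eq _ h2]
  rw [← Real.log_le_log_iff (by positivity) (by positivity), Real.log_pow,
    Real.log_mul (by positivity) (by positivity), Real.log_mul (by positivity) p0.ne',
    Real.log_mul (by positivity) p1.ne', Real.log_mul (by positivity) p2.ne',
    Real.log_mul (by positivity) (by positivity), Real.log_mul (by positivity) (by positivity),
    Real.log_mul (by positivity) (by positivity), Real.log_exp, Real.log_exp, Real.log_exp]
  push_cast
  linarith

theorem odd_redundancy_upper (r : ℝ) (hr : 0 < r) :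
    ∀ s > (0 : ℝ),
      theta3 r ^ 2 - 2 * thetaO r ^ 2 ≤
        theta3 (r * s) * theta3 (r / s) - 2 * thetaO (r * s) * thetaO (r / s) := by
  intro s hs
  have h1 := main3 r s hr hs
  have h2 := main2 r s hr hs
  linarith
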